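/- arXiv:2410.22515 — 7 statements merged into one kernel-verified Lean document; each statement's English description precedes it below -/
import Mathlib

section
/- Let (C, K) be a category with covers and R a hom-relation on C that is an equivalence relation on every hom-set and preserves composition. Assume every covering is through monomorphisms: whenever a family of morphisms {f_j : D_j → Z} generates a covering sieve on an object Z, there exists a family of monomorphisms {u_i : Z_i → Z} generating the same sieve. Then for every morphism f : X → Y and every m ≥ 1: if there is a covering {g_j : Y_j → Y}_{j=1}^m of Y such that f admits an R-g_j-section for every j, then there is a covering {h_j : U_j → Y}_{j=1}^m of Y consisting of monomorphisms such that f admits an R-h_j-section for every j. (Hence the R-sectional number of f equals its R-mono sectional number.) -/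
open CategoryTheory

/-- A morphism lies in the sieve generated by a family iff it factors through a member. -/
lemma generate_ofArrows_iff_factors {C : Type*} [Category C] {Z : C} {ι : Type*}
    (D : ι → C) (g : ∀ i, D i ⟶ Z) {W : C} (p : W ⟶ Z) :
    Sieve.generate (Presieve.ofArrows D g) p ↔ ∃ (i : ι) (a : W ⟶ D i), a ≫ g i = p := by
  constructor
  · rintro ⟨_, a, _, ⟨i⟩, rfl⟩
    exact ⟨i, a, rfl⟩
  · rintro ⟨i, a, rfl⟩
    exact ⟨_, a, _, ⟨i⟩, rfl⟩

/-- **Sectional number equals mono sectional number when covers are through monomorphisms.**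
In a category with covers `(C, K)` with a hom-relation `R` that is an equivalence on
every hom-set and preserves composition, if every covering sieve is generated by a family
of monomorphisms, then any `m`-fold covering admitting `R`-sections of `f` can be replaced
by an `m`-fold covering by monomorphisms admitting `R`-sections of `f`. -/
theorem rsec_eq_rmsec_of_covers_through_mono {C : Type*} [Category C]
    (K : ∀ X : C, Set (Sieve X))
    (R : ∀ ⦃c c' : C⦄, (c ⟶ c') → (c ⟶ c') → Prop)
    (hEquiv : ∀ c c' : C, Equivalence (fun f g : c ⟶ c' => R f g))
    (hComp : ∀ {a b c : C} {f h : a ⟶ b} {f' h' : b ⟶ c},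
      R f h → R f' h' → R (f ≫ f') (h ≫ h'))
    (hThroughMono : ∀ {Z : C} {ι : Type} (Dj : ι → C) (gj : ∀ j, Dj j ⟶ Z),
      Sieve.generate (Presieve.ofArrows Dj gj) ∈ K Z →
      ∃ (κ : Type) (Zi : κ → C) (ui : ∀ i, Zi i ⟶ Z), (∀ i, Mono (ui i)) ∧
        Sieve.generate (Presieve.ofArrows Zi ui) =
          Sieve.generate (Presieve.ofArrows Dj gj))
    {X Y : C} (f : X ⟶ Y) (m : ℕ) (hm : 1 ≤ m)
    (Yj : Fin m → C) (g : ∀ j, Yj j ⟶ Y)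
    (hcov : Sieve.generate (Presieve.ofArrows Yj g) ∈ K Y)
    (hsec : ∀ j, ∃ s : Yj j ⟶ X, R (s ≫ f) (g j)) :
    ∃ (Uj : Fin m → C) (h : ∀ j, Uj j ⟶ Y),
      Sieve.generate (Presieve.ofArrows Uj h) ∈ K Y ∧ (∀ j, Mono (h j)) ∧
      ∀ j, ∃ s : Uj j ⟶ X, R (s ≫ f) (h j) := by
  obtain ⟨κ, Z, u, hu, hgen⟩ := hThroughMono Yj g hcov
  have hg : ∀ j, ∃ (i : κ) (a : Yj j ⟶ Z i), a ≫ u i = g j := fun j => by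
    rw [← generate_ofArrows_iff_factors, hgen, generate_ofArrows_iff_factors]
    exact ⟨j, 𝟙 _, Category.id_comp _⟩
  have hu' : ∀ i, ∃ (k : Fin m) (b : Z i ⟶ Yj k), b ≫ g k = u i := fun i => by
    rw [← generate_ofArrows_iff_factors, ← hgen, generate_ofArrows_iff_factors]
    exact ⟨i, 𝟙 _, Category.id_comp _⟩
  choose i a ha using hg
  refine ⟨fun j => Z (i j), fun j => u (i j), ?_, fun j => hu (i j), fun j => ?_⟩
  · convert hcov using 1
    ext W p
    simp only [generate_ofArrows_iff_factors]
    constructor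
    · rintro ⟨j, c, rfl⟩
      obtain ⟨k, b, hb⟩ := hu' (i j)
      exact ⟨k, c ≫ b, by rw [Category.assoc, hb]⟩
    · rintro ⟨j, c, rfl⟩
      exact ⟨j, c ≫ a j, by rw [Category.assoc, ha]⟩
  · obtain ⟨k, b, hb⟩ := hu' (i j)
    obtain ⟨s, hs⟩ := hsec k
    refine ⟨b ≫ s, ?_⟩
    beta_reduce
    rw [← hb, Category.assoc]
    exact hComp ((hEquiv _ _).refl b) hs
end

section
/- Let C be a category equipped with a quasi Grothendieck topology K, and assume C has weak pullbacks (for any morphisms f : X → Y and φ : Y' → Y there exist an object X' and morphisms f' : X' → Y', φ' : X' → X forming a weak pullback square f ∘ φ' = φ ∘ f'). Suppose the commutative square f ∘ φ' = φ ∘ f' (with φ' : X' → X, f' : X' → Y', φ : Y' → Y, f : X → Y) is a weak pullback. Then for every m: if there is a covering {h_i : E_i → Y}_{i=1}^m of Y (i.e., the sieve it generates lies in K(Y)) such that each h_i factors through f (h_i = f ∘ s_i for some s_i : E_i → X), then there is a covering {h̃_i : Ẽ_i → Y'}_{i=1}^m of Y' such that each h̃_i factors through f'. Hence sec(f') ≤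 sec(f). -/
open CategoryTheory

/-- A commutative square `φ' ≫ f = f' ≫ φ` is a weak pullback if every cone over the
cospan factors (not necessarily uniquely) through it. -/
def IsWeakPullback {C : Type*} [Category C] {X' X Y' Y : C}
    (φ' : X' ⟶ X) (f' : X' ⟶ Y') (φ : Y' ⟶ Y) (f : X ⟶ Y) : Prop :=
  φ' ≫ f = f' ≫ φ ∧
    ∀ ⦃Z : C⦄ (α : Z ⟶ Y') (β : Z ⟶ X), α ≫ φ = β ≫ f →
      ∃ h : Z ⟶ X', h ≫ f' = α ∧ h ≫ φ' = β

/-- The sectional number of `f : X ⟶ Y` with respect to covers `K`: the least `m` for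
which there is a covering of `Y` by `m` morphisms each factoring through `f`. -/
noncomputable def Sec {C : Type*} [Category C] (K : ∀ X : C, Set (Sieve X))
    {X Y : C} (f : X ⟶ Y) : ℕ∞ :=
  sInf {n : ℕ∞ | ∃ m : ℕ, n = m ∧ ∃ (Z : Fin m → C) (g : ∀ j, Z j ⟶ Y),
    Sieve.generate (Presieve.ofArrows Z g) ∈ K Y ∧
    ∀ j, ∃ s : Z j ⟶ X, s ≫ f = g j}

/-- Pasting weak pullback squares horizontally: the arrow to `X` over `Y` lifts to an arrow
to `X'` over `Y'`. -/
theorem IsWeakPullback.exists_lift {C : Type*} [Category C] {X' X Y' Y E P : C}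
    {φ' : X' ⟶ X} {f' : X' ⟶ Y'} {φ : Y' ⟶ Y} {f : X ⟶ Y}
    (hsq : IsWeakPullback φ' f' φ f) {h : E ⟶ Y} {p : P ⟶ E} {q : P ⟶ Y'}
    (hP : p ≫ h = q ≫ φ) (hs : ∃ s : E ⟶ X, s ≫ f = h) : ∃ t : P ⟶ X', t ≫ f' = q := by
  obtain ⟨s, rfl⟩ := hs
  obtain ⟨t, ht, -⟩ := hsq.2 q (p ≫ s) (by simp [hP])
  exact ⟨t, ht⟩

/-- The pullback of a generated sieve is generated by weak pullbacks of the generators. -/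
theorem pullback_generate_ofArrows_of_isWeakPullback {C : Type*} [Category C] {ι : Type*}
    {Y Y' : C} (φ : Y' ⟶ Y) {E P : ι → C} {h : ∀ i, E i ⟶ Y} {p : ∀ i, P i ⟶ E i}
    {q : ∀ i, P i ⟶ Y'} (hP : ∀ i, IsWeakPullback (p i) (q i) φ (h i)) :
    Sieve.pullback φ (Sieve.generate (Presieve.ofArrows E h)) =
      Sieve.generate (Presieve.ofArrows P q) := by
  ext Z a
  constructor
  · rintro ⟨_, u, _, ⟨i⟩, hu⟩
    obtain ⟨t, ht, -⟩ := (hP i).2 a u hu.symm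
    exact ⟨P i, t, q i, ⟨i⟩, ht⟩
  · rintro ⟨_, u, _, ⟨i⟩, rfl⟩
    exact ⟨E i, u ≫ p i, h i, ⟨i⟩, by simp [(hP i).1]⟩

/-- **Sectional number under weak pullbacks.**
In a category with a quasi Grothendieck topology `K` and weak pullbacks, if the square
`φ' ≫ f = f' ≫ φ` is a weak pullback, then every covering of `Y` by morphisms factoring
through `f` yields a covering of `Y'` by morphisms factoring through `f'`; hence
`sec(f') ≤ sec(f)`. -/
theorem sec_le_of_weakPullback {C : Type*} [Category C]
    (K : ∀ X : C, Set (Sieve X))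
    (hT1 : ∀ X : C, (⊤ : Sieve X) ∈ K X)
    (hT2 : ∀ {D E : C} (f : D ⟶ E), ∀ S ∈ K E, Sieve.pullback f S ∈ K D)
    (hwpb : ∀ {X Y Y' : C} (f : X ⟶ Y) (φ : Y' ⟶ Y),
      ∃ (X' : C) (f' : X' ⟶ Y') (φ' : X' ⟶ X), IsWeakPullback φ' f' φ f)
    {X X' Y Y' : C} (f : X ⟶ Y) (f' : X' ⟶ Y') (φ : Y' ⟶ Y) (φ' : X' ⟶ X)
    (hsq : IsWeakPullback φ' f' φ f) :
    (∀ (m : ℕ) (E : Fin m → C) (h : ∀ i, E i ⟶ Y),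
      Sieve.generate (Presieve.ofArrows E h) ∈ K Y →
      (∀ i, ∃ s : E i ⟶ X, s ≫ f = h i) →
      ∃ (Et : Fin m → C) (ht : ∀ i, Et i ⟶ Y'),
        Sieve.generate (Presieve.ofArrows Et ht) ∈ K Y' ∧
        ∀ i, ∃ s : Et i ⟶ X', s ≫ f' = ht i) ∧
    Sec K f' ≤ Sec K f := by
  
  have lift_covering : ∀ (m : ℕ) (E : Fin m → C) (h : ∀ i, E i ⟶ Y),
      Sieve.generate (Presieve.ofArrows E h) ∈ K Y →
      (∀ i, ∃ s : E i ⟶ X, s ≫ f = h i) →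
      ∃ (Et : Fin m → C) (ht : ∀ i, Et i ⟶ Y'),
        Sieve.generate (Presieve.ofArrows Et ht) ∈ K Y' ∧
        ∀ i, ∃ s : Et i ⟶ X', s ≫ f' = ht i := by
    intro m E h hK hs
    choose P q p hP using fun i => hwpb (h i) φ
    refine ⟨P, q, ?_, fun i => hsq.exists_lift (hP i).1 (hs i)⟩
    rw [← pullback_generate_ofArrows_of_isWeakPullback φ hP]
    exact hT2 φ _ hK
  refine ⟨lift_covering, sInf_le_sInf ?_⟩
  rintro _ ⟨m, rfl, E, h, hK, hs⟩
  exact ⟨m, rfl, lift_covering m E h hK hs⟩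
end

section
/- Let C be a category with pullbacks equipped with a quasi Grothendieck topology K, and suppose the commutative square f ∘ φ' = φ ∘ f' (with φ' : X' → X, f' : X' → Y', φ : Y' → Y, f : X → Y) is a weak pullback. Then for every m: if there is a covering {h_i : E_i → Y}_{i=1}^m of Y by monomorphisms such that each h_i factors through f, then there is a covering {h̃_i : Ẽ_i → Y'}_{i=1}^m of Y' by monomorphisms such that each h̃_i factors through f'. Hence msec(f') ≤ msec(f). -/
open CategoryTheory

/-- The mono sectional number of `f : X ⟶ Y` with respect to covers `K`: the least `m`
for which there is a covering of `Y` by `m` monomorphisms each factoring through `f`. -/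
noncomputable def MSec {C : Type*} [Category C] (K : ∀ X : C, Set (Sieve X))
    {X Y : C} (f : X ⟶ Y) : ℕ∞ :=
  sInf {n : ℕ∞ | ∃ m : ℕ, n = m ∧ ∃ (Z : Fin m → C) (g : ∀ j, Z j ⟶ Y),
    Sieve.generate (Presieve.ofArrows Z g) ∈ K Y ∧ (∀ j, Mono (g j)) ∧
    ∀ j, ∃ s : Z j ⟶ X, s ≫ f = g j}

/-- The pullback of the sieve generated by an indexed family is generated by the family of
base changes. -/
theorem generate_ofArrows_pullback_fst {C : Type*} [Category C] [Limits.HasPullbacks C]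
    {ι : Type*} {Y Y' : C} (φ : Y' ⟶ Y) (E : ι → C) (h : ∀ i, E i ⟶ Y) :
    Sieve.generate (Presieve.ofArrows (fun i => Limits.pullback φ (h i))
      fun i => Limits.pullback.fst φ (h i)) =
      (Sieve.generate (Presieve.ofArrows E h)).pullback φ := by
  ext Z g
  constructor
  · rintro ⟨_, u, _, ⟨i⟩, rfl⟩
    exact ⟨_, u ≫ Limits.pullback.snd φ (h i), _, ⟨i⟩, by
      simp [Limits.pullback.condition]⟩
  · rintro ⟨_, u, _, ⟨i⟩, hu⟩
    exact ⟨_, Limits.pullback.lift g u hu.symm, _, ⟨i⟩, Limits.pullback.lift_fst _ _ _⟩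

/-- **Mono sectional number under weak pullbacks.**
In a category with pullbacks equipped with a quasi Grothendieck topology `K`, if the
square `φ' ≫ f = f' ≫ φ` is a weak pullback, then every covering of `Y` by monomorphisms
factoring through `f` yields a covering of `Y'` by monomorphisms factoring through `f'`;
hence `msec(f') ≤ msec(f)`. -/
theorem msec_le_of_weakPullback {C : Type*} [Category C] [Limits.HasPullbacks C]
    (K : ∀ X : C, Set (Sieve X))
    (hT1 : ∀ X : C, (⊤ : Sieve X) ∈ K X)
    (hT2 : ∀ {D E : C} (f : D ⟶ E), ∀ S ∈ K E, Sieve.pullback f S ∈ K D)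
    {X X' Y Y' : C} (f : X ⟶ Y) (f' : X' ⟶ Y') (φ : Y' ⟶ Y) (φ' : X' ⟶ X)
    (hsq : IsWeakPullback φ' f' φ f) :
    (∀ (m : ℕ) (E : Fin m → C) (h : ∀ i, E i ⟶ Y),
      Sieve.generate (Presieve.ofArrows E h) ∈ K Y → (∀ i, Mono (h i)) →
      (∀ i, ∃ s : E i ⟶ X, s ≫ f = h i) →
      ∃ (Et : Fin m → C) (ht : ∀ i, Et i ⟶ Y'),
        Sieve.generate (Presieve.ofArrows Et ht) ∈ K Y' ∧ (∀ i, Mono (ht i)) ∧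
        ∀ i, ∃ s : Et i ⟶ X', s ≫ f' = ht i) ∧
    MSec K f' ≤ MSec K f := by
  refine (and_iff_left_of_imp fun key => sInf_le_sInf ?_).mpr ?_
  · rintro _ ⟨m, rfl, E, h, hK, hmono, hs⟩
    exact ⟨m, rfl, key m E h hK hmono hs⟩
  · intro m E h hK hmono hs
    refine ⟨fun i => Limits.pullback φ (h i), fun i => Limits.pullback.fst φ (h i), ?_, ?_, ?_⟩
    · rw [generate_ofArrows_pullback_fst]
      exact hT2 φ _ hK
    · intro i
      have := hmono i
      infer_instance
    · intro i
      obtain ⟨s, hs⟩ := hs i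
      obtain ⟨t, ht, -⟩ := hsq.2 (Limits.pullback.fst φ (h i))
        (Limits.pullback.snd φ (h i) ≫ s) (by rw [Category.assoc, hs, Limits.pullback.condition])
      exact ⟨t, ht⟩
end

section
/- Let (C, K) and (D, L) be categories with covers, R a hom-relation on C and R' a hom-relation on D. Let F : C → D be a functor that is continuous, i.e., whenever {i_λ : A_λ → X} is a covering of X in (C, K), the family {F(i_λ) : F(A_λ) → F(X)} is a covering of F(X) in (D, L), and suppose F(f) R' F(g) whenever f R g. Then for every morphism f : X → Y in C and every m: if there is a covering {g_j : Y_j → Y}_{j=1}^m of Y such that f admits an R-g_j-section for each j, then {F(g_j)}_{j=1}^m is a covering of F(Y) such that F(f) admits an R'-F(g_j)-section for each j; hence R'-sec(F(f)) ≤ R-sec(f). If moreover F preserves monomorphisms, the same holds with coverings by monomorphisms, so R'-msec(F(f)) ≤ R-msec(f). -/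
open CategoryTheory

/-- The `R`-sectional number of a morphism `f : X ⟶ Y` in a category with covers `(C, K)`. -/
noncomputable def RSec {C : Type*} [Category C] (K : ∀ X : C, Set (Sieve X))
    (R : ∀ ⦃c c' : C⦄, (c ⟶ c') → (c ⟶ c') → Prop) {X Y : C} (f : X ⟶ Y) : ℕ∞ :=
  sInf {n : ℕ∞ | ∃ m : ℕ, n = m ∧ ∃ (Z : Fin m → C) (g : ∀ j, Z j ⟶ Y),
    Sieve.generate (Presieve.ofArrows Z g) ∈ K Y ∧
    ∀ j, ∃ s : Z j ⟶ X, R (s ≫ f) (g j)}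

/-- The `R`-mono sectional number of a morphism `f : X ⟶ Y`. -/
noncomputable def RMSec {C : Type*} [Category C] (K : ∀ X : C, Set (Sieve X))
    (R : ∀ ⦃c c' : C⦄, (c ⟶ c') → (c ⟶ c') → Prop) {X Y : C} (f : X ⟶ Y) : ℕ∞ :=
  sInf {n : ℕ∞ | ∃ m : ℕ, n = m ∧ ∃ (Z : Fin m → C) (g : ∀ j, Z j ⟶ Y),
    Sieve.generate (Presieve.ofArrows Z g) ∈ K Y ∧ (∀ j, Mono (g j)) ∧
    ∀ j, ∃ s : Z j ⟶ X, R (s ≫ f) (g j)}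

/-- **Sectional numbers under continuous functors.**
Let `F : C ⥤ D` be a functor carrying coverings to coverings and the relation `R` to the
relation `R'`. Then the image under `F` of a covering admitting `R`-sections of `f` is a
covering admitting `R'`-sections of `F.map f`; hence `R'-sec(F f) ≤ R-sec(f)`.
If `F` moreover preserves monomorphisms, the same holds for coverings by monomorphisms,
so `R'-msec(F f) ≤ R-msec(f)`. -/
theorem rsec_le_of_continuous_functor {C : Type*} [Category C] {D : Type*} [Category D]
    (K : ∀ X : C, Set (Sieve X)) (L : ∀ X : D, Set (Sieve X))
    (R : ∀ ⦃c c' : C⦄, (c ⟶ c') → (c ⟶ c') → Prop)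
    (R' : ∀ ⦃d d' : D⦄, (d ⟶ d') → (d ⟶ d') → Prop)
    (F : C ⥤ D)
    (hcont : ∀ {X : C} {ι : Type} (A : ι → C) (i : ∀ l, A l ⟶ X),
      Sieve.generate (Presieve.ofArrows A i) ∈ K X →
      Sieve.generate (Presieve.ofArrows (fun l => F.obj (A l)) (fun l => F.map (i l))) ∈
        L (F.obj X))
    (hrel : ∀ {c c' : C} {f g : c ⟶ c'}, R f g → R' (F.map f) (F.map g))
    {X Y : C} (f : X ⟶ Y) :
    (∀ (m : ℕ) (Yj : Fin m → C) (g : ∀ j, Yj j ⟶ Y),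
      Sieve.generate (Presieve.ofArrows Yj g) ∈ K Y →
      (∀ j, ∃ s : Yj j ⟶ X, R (s ≫ f) (g j)) →
      Sieve.generate (Presieve.ofArrows (fun j => F.obj (Yj j))
          (fun j => F.map (g j))) ∈ L (F.obj Y) ∧
        ∀ j, ∃ s' : F.obj (Yj j) ⟶ F.obj X, R' (s' ≫ F.map f) (F.map (g j))) ∧
    RSec L R' (F.map f) ≤ RSec K R f ∧
    ((∀ {A B : C} (u : A ⟶ B), Mono u → Mono (F.map u)) →
      RMSec L R' (F.map f) ≤ RMSec K R f) := by
  have map_section {m : ℕ} {Z : Fin m → C} {g : ∀ j, Z j ⟶ Y}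
      (hs : ∀ j, ∃ s : Z j ⟶ X, R (s ≫ f) (g j)) (j : Fin m) :
      ∃ s' : F.obj (Z j) ⟶ F.obj X, R' (s' ≫ F.map f) (F.map (g j)) := by
    obtain ⟨s, hs⟩ := hs j
    exact ⟨F.map s, by simpa only [F.map_comp] using hrel hs⟩
  refine ⟨fun m Z g hg hs => ⟨hcont Z g hg, map_section hs⟩, ?_, fun hF => ?_⟩
  · refine sInf_le_sInf ?_
    rintro _ ⟨m, rfl, Z, g, hg, hs⟩
    exact ⟨m, rfl, _, _, hcont Z g hg, map_section hs⟩
  · refine sInf_le_sInf ?_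
    rintro _ ⟨m, rfl, Z, g, hg, hmono, hs⟩
    exact ⟨m, rfl, _, _, hcont Z g hg, fun j => hF _ (hmono j), map_section hs⟩
end

section
/- Let (C, K) be a category with covers possessing a weak initial object I (for every object X of C there exists at least one morphism I → X), and let R be a hom-relation on C that is an equivalence relation on every hom-set and preserves composition. Let f : X → Y be a morphism and suppose Y is R-connected, i.e., any two morphisms I → Y are R-related. Then for every morphism i : I → Y and every covering {g_j : Y_j → Y}_{j=1}^m of Y such that i admits an R-g_j-section for each j, the morphism f also admits an R-g_j-section for each j. Hence R-sec(f) ≤ cat_R(Y), where cat_R(Y) := R-sec(i) for any (equivalently, some) morphism i : I → Y. -/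
open CategoryTheory

/-- **Upper bound of the `R`-sectional number by the LS category.**
If `I` is a weak initial object and `Y` is `R`-connected (any two morphisms `I ⟶ Y` are
`R`-related), then for any morphism `i : I ⟶ Y`, every covering admitting `R`-sections of
`i` also admits `R`-sections of `f : X ⟶ Y`; hence `R-sec(f) ≤ cat_R(Y) = R-sec(i)`. -/
theorem rsec_le_catR {C : Type*} [Category C] (K : ∀ X : C, Set (Sieve X))
    (R : ∀ ⦃c c' : C⦄, (c ⟶ c') → (c ⟶ c') → Prop)
    (hEquiv : ∀ c c' : C, Equivalence (fun f g : c ⟶ c' => R f g))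
    (hComp : ∀ {a b c : C} {f h : a ⟶ b} {f' h' : b ⟶ c},
      R f h → R f' h' → R (f ≫ f') (h ≫ h'))
    (I : C) (hI : ∀ X : C, Nonempty (I ⟶ X))
    {X Y : C} (f : X ⟶ Y)
    (hconn : ∀ i i' : I ⟶ Y, R i i') :
    ∀ i : I ⟶ Y,
      (∀ (m : ℕ) (Yj : Fin m → C) (g : ∀ j, Yj j ⟶ Y),
        Sieve.generate (Presieve.ofArrows Yj g) ∈ K Y →
        (∀ j, ∃ s : Yj j ⟶ I, R (s ≫ i) (g j)) →
        ∀ j, ∃ s' : Yj j ⟶ X, R (s' ≫ f) (g j)) ∧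
      RSec K R f ≤ RSec K R i := by
  intro i
  have sections {Z : C} (g : Z ⟶ Y) (h : ∃ s : Z ⟶ I, R (s ≫ i) g) :
      ∃ s' : Z ⟶ X, R (s' ≫ f) g := by
    obtain ⟨s, hs⟩ := h
    obtain ⟨p⟩ := hI X
    refine ⟨s ≫ p, (hEquiv Z Y).trans ?_ hs⟩
    rw [Category.assoc]
    exact hComp ((hEquiv Z I).refl s) (hconn (p ≫ f) i)
  refine ⟨fun m Yj g _ h j => sections (g j) (h j), sInf_le_sInf ?_⟩
  rintro n ⟨m, hn, Z, g, hK, h⟩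
  exact ⟨m, hn, Z, g, hK, fun j => sections (g j) (h j)⟩
end

section
/- For every n ∈ ℕ and every family Q₁, …, Qₙ of proper additive subgroups of the rational numbers (Qᵢ ≠ ℚ for each i), the union Q₁ ∪ … ∪ Qₙ is not all of ℚ. In other words, (ℚ, +) cannot be written as a union of finitely many proper subgroups, i.e., its covering number σ(ℚ) is infinite. -/
/-- The only finite-index subgroup of a `ℚ`-vector space is the whole space. -/
theorem AddSubgroup.eq_top_of_finiteIndex_of_module_rat {V : Type*} [AddCommGroup V] [Module ℚ V]
    (H : AddSubgroup V) [H.FiniteIndex] : H = ⊤ := by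
  refine (AddSubgroup.eq_top_iff' H).mpr fun x ↦ ?_
  have hindex : (H.index : ℚ) ≠ 0 := Nat.cast_ne_zero.mpr AddSubgroup.FiniteIndex.index_ne_zero
  have hmem := H.nsmul_index_mem ((H.index : ℚ)⁻¹ • x)
  rwa [← Nat.cast_smul_eq_nsmul ℚ, smul_inv_smul₀ hindex] at hmem

/-- **`(ℚ, +)` is not a finite union of proper subgroups.**
For every `n` and every family `Q₁, …, Qₙ` of proper additive subgroups of `ℚ`, the
union `Q₁ ∪ … ∪ Qₙ` is not all of `ℚ`; i.e. the covering number `σ(ℚ)` is infinite. -/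
theorem rat_not_union_of_proper_addSubgroups (n : ℕ) (Q : Fin n → AddSubgroup ℚ)
    (hQ : ∀ i, Q i ≠ ⊤) :
    (⋃ i, (Q i : Set ℚ)) ≠ Set.univ := by
  intro hcovers
  open scoped Pointwise in
  have hcosets : ⋃ i ∈ Finset.univ, (0 : ℚ) +ᵥ (Q i : Set ℚ) = Set.univ := by
    simpa using hcovers
  obtain ⟨k, -, hk⟩ := AddSubgroup.exists_finiteIndex_of_leftCoset_cover hcosets
  exact hQ k (Q k).eq_top_of_finiteIndex_of_module_rat
end

section
/- Let S¹ denote the circle group of unit complex numbers and p : ℝ → S¹ the map p(r) = e^{2πir}. Then the map g : ℝ × ℝ → S¹ × S¹, g(r, r') = (p(r), p(r')), is a surjective local homeomorphism, and the map σ : ℝ × ℝ → C([0,1], S¹) defined by σ(r, r')(t) = e^{2πi((1−t)r + t r')} is continuous (with respect to the compact-open topology on C([0,1], S¹)) and satisfies σ(r, r')(0) = p(r) and σ(r, r')(1) = p(r') for all (r, r') ∈ ℝ × ℝ. -/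
open Real

theorem IsLocalHomeomorph.prodMap {X Y Z W : Type*} [TopologicalSpace X] [TopologicalSpace Y]
    [TopologicalSpace Z] [TopologicalSpace W] {f : X → Y} {g : Z → W}
    (hf : IsLocalHomeomorph f) (hg : IsLocalHomeomorph g) :
    IsLocalHomeomorph (Prod.map f g) := by
  rintro ⟨x, z⟩
  obtain ⟨e, hx, rfl⟩ := hf x
  obtain ⟨e', hz, rfl⟩ := hg z
  exact ⟨e.prod e', ⟨hx, hz⟩, rfl⟩

theorem Circle.surjective_exp_two_pi_mul :
    Function.Surjective fun r : ℝ => Circle.exp (2 * π * r) :=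
  Circle.exp_surjective.comp (mul_left_surjective₀ two_pi_pos.ne')

theorem Circle.isLocalHomeomorph_exp_two_pi_mul :
    IsLocalHomeomorph fun r : ℝ => Circle.exp (2 * π * r) :=
  isLocalHomeomorph_circleExp.comp (Homeomorph.mulLeft₀ (2 * π) two_pi_pos.ne').isLocalHomeomorph

/-- **Étale topological complexity of the circle is 1 — the witnessing data.**
With `p : ℝ → S¹`, `p r = e^{2πir}`, the map `g(r, r') = (p r, p r')` is a surjective
local homeomorphism, and there is a continuous map `σ : ℝ × ℝ → C([0,1], S¹)` (for the
compact-open topology) with `σ(r, r')(t) = e^{2πi((1-t)r + tr')}`, so that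
`σ(r, r')(0) = p r` and `σ(r, r')(1) = p r'`. -/
theorem circle_etale_tc_witness :
    Function.Surjective
      (fun rr : ℝ × ℝ => (Circle.exp (2 * π * rr.1), Circle.exp (2 * π * rr.2))) ∧
    IsLocalHomeomorph
      (fun rr : ℝ × ℝ => (Circle.exp (2 * π * rr.1), Circle.exp (2 * π * rr.2))) ∧
    ∃ σ : ℝ × ℝ → C(unitInterval, Circle),
      Continuous σ ∧
      (∀ (r r' : ℝ) (t : unitInterval),
        σ (r, r') t = Circle.exp (2 * π * ((1 - (t : ℝ)) * r + (t : ℝ) * r'))) ∧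
      (∀ r r' : ℝ,
        σ (r, r') 0 = Circle.exp (2 * π * r) ∧ σ (r, r') 1 = Circle.exp (2 * π * r')) := by
  refine ⟨Circle.surjective_exp_two_pi_mul.prodMap Circle.surjective_exp_two_pi_mul,
    Circle.isLocalHomeomorph_exp_two_pi_mul.prodMap Circle.isLocalHomeomorph_exp_two_pi_mul, ?_⟩
  let F : C((ℝ × ℝ) × unitInterval, Circle) :=
    ⟨fun q => Circle.exp (2 * π * ((1 - (q.2 : ℝ)) * q.1.1 + (q.2 : ℝ) * q.1.2)), by fun_prop⟩
  exact ⟨F.curry, F.curry.continuous, fun _ _ _ => rfl, fun _ _ => by simp [F]⟩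
end
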